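/- arXiv:1801.06654 — 2 statements merged into one kernel-verified Lean document; each statement's English description precedes it below -/
import Mathlib

section
/- Let A be a finite De Morgan monoid in which e is join-prime (e ≤ a ∨ b implies e ≤ a or e ≤ b, i.e., A is finitely subdirectly irreducible) and e ≰ f (as happens when the four-element De Morgan monoid D4, in which e and f are incomparable, is a subalgebra of A). Then the cardinality of A is even. -/
/-- An involutive (commutative) residuated lattice (IRL). -/
class IRL (α : Type*) extends Lattice α, CommMonoid α where
  neg : α → α
  neg_neg : ∀ x : α, neg (neg x) = x
  resid_law : ∀ x y z : α, x * y ≤ z ↔ neg z * y ≤ neg x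

namespace IRL

variable {α : Type*} [IRL α]

/-- `f := ¬e`. -/
def f : α := neg 1

/-- `x → y := ¬(x · ¬y)`. -/
def arrow (x y : α) : α := neg (x * neg y)

/-- `q(x) := (f·f) → (¬x · ¬x)`. -/
def qq (x : α) : α := arrow (f * f) (neg x * neg x)

end IRL

namespace IRL

variable {α : Type*} [IRL α]

theorem neg_antitone : Antitone (neg : α → α) := fun x y h => by
  simpa using (resid_law x 1 y).1 (by simpa using h)

theorem mul_le_mul_of_le_right {a b : α} (h : a ≤ b) (y : α) : a * y ≤ b * y :=
  (resid_law a y _).2 (((resid_law b y _).1 le_rfl).trans (neg_antitone h))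

theorem mul_le_mul_of_le {a b c d : α} (h : a ≤ b) (k : c ≤ d) : a * c ≤ b * d := by
  refine (mul_le_mul_of_le_right h c).trans ?_
  rw [mul_comm b c, mul_comm b d]
  exact mul_le_mul_of_le_right k b

theorem mul_neg_le_f (x : α) : x * neg x ≤ f :=
  (resid_law _ _ _).2 (by simp [f, neg_neg])

theorem one_le_sup_neg (sq : ∀ x : α, x ≤ x * x) (x : α) : 1 ≤ x ⊔ neg x := by
  have h : neg (x ⊔ neg x) ≤ neg x := neg_antitone le_sup_left
  have k : neg (x ⊔ neg x) ≤ x := by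
    simpa only [neg_neg] using neg_antitone (le_sup_right : neg x ≤ x ⊔ neg x)
  have hf : neg (x ⊔ neg x) ≤ f :=
    ((sq _).trans (mul_le_mul_of_le k h)).trans (mul_neg_le_f x)
  simpa only [f, neg_neg] using neg_antitone hf

theorem neg_ne_self (sq : ∀ x : α, x ≤ x * x)
    (hef : ¬ (1 : α) ≤ f) (x : α) : neg x ≠ x := by
  intro hx
  have h : 1 ≤ x := by simpa [hx] using one_le_sup_neg sq x
  have k : x ≤ f := hx ▸ neg_antitone h
  exact hef (h.trans k)

end IRL

/-- A finite finitely subdirectly irreducible De Morgan monoid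
(`e` join-prime) with `e ≰ f` has even cardinality. -/
theorem stmt17 {A : Type*} [IRL A] [Fintype A]
    (sq : ∀ x : A, x ≤ x * x)
    (hdistrib : ∀ x y z : A, x ⊓ (y ⊔ z) = (x ⊓ y) ⊔ (x ⊓ z))
    (hjp : ∀ a b : A, (1 : A) ≤ a ⊔ b → 1 ≤ a ∨ 1 ≤ b)
    (hef : ¬ (1 : A) ≤ IRL.f) :
    Even (Fintype.card A) := by
  classical
  have hfix : IsEmpty (Function.fixedPoints (IRL.neg : A → A)) :=
    ⟨fun x => IRL.neg_ne_self sq hef x.1 x.2⟩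
  have hmod := Equiv.Perm.card_fixedPoints_modEq
    (f := (IRL.neg : Function.End A)) (p := 2) (n := 1)
    (by funext x; exact IRL.neg_neg x)
  rw [Fintype.card_eq_zero_iff.2 hfix] at hmod
  exact even_iff_two_dvd.2 (Nat.modEq_zero_iff_dvd.1 hmod)
end

section
/- Every square-increasing IRL satisfies: if f ≤ x then x·x·x = x·x; in particular, f·f·f = f·f. -/
namespace IRL

theorem neg_le_neg_of_le {α : Type*} [IRL α] {x y : α} (h : x ≤ y) : neg y ≤ neg x := by
  have := (resid_law x 1 y).1 (by rwa [mul_one])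
  rwa [mul_one] at this

theorem mul_le_mul_of_le_s19 {α : Type*} [IRL α] {x y : α} (z : α) (h : x ≤ y) :
    x * z ≤ y * z :=
  (resid_law x z (y * z)).2
    (((resid_law y z (y * z)).1 le_rfl).trans (neg_le_neg_of_le h))

theorem neg_le_one_of_f_le {α : Type*} [IRL α] {x : α} (h : f ≤ x) : neg x ≤ 1 := by
  have := neg_le_neg_of_le h
  rwa [f, neg_neg] at this

theorem cube_eq_sq_of_f_le {α : Type*} [IRL α] (sq : ∀ x : α, x ≤ x * x) {x : α}
    (h : f ≤ x) : x * x * x = x * x := by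
  refine le_antisymm ?_ (mul_le_mul_of_le_s19 x (sq x))
  set c := neg (x * x)
  have hcx : c * x ≤ neg x := (resid_law x x (x * x)).1 le_rfl
  have key : c * (x * x) ≤ neg x :=
    calc c * (x * x) ≤ c * c * (x * x) := mul_le_mul_of_le_s19 _ (sq c)
      _ = c * x * (c * x) := mul_mul_mul_comm c c x x
      _ ≤ neg x * (c * x) := mul_le_mul_of_le_s19 _ hcx
      _ ≤ 1 * (c * x) := mul_le_mul_of_le_s19 _ (neg_le_one_of_f_le h)
      _ = c * x := one_mul _
      _ ≤ neg x := hcx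
  rw [mul_assoc]
  exact (resid_law x (x * x) (x * x)).2 key

end IRL

/-- Every square-increasing IRL satisfies: if `f ≤ x` then
`x·x·x = x·x`; in particular, `f·f·f = f·f`. -/
theorem stmt19 {A : Type*} [IRL A] (sq : ∀ x : A, x ≤ x * x) :
    (∀ x : A, IRL.f ≤ x → x * x * x = x * x) ∧
    (IRL.f : A) * IRL.f * IRL.f = (IRL.f : A) * IRL.f := by
  exact ⟨fun _ h => IRL.cube_eq_sq_of_f_le sq h, IRL.cube_eq_sq_of_f_le sq le_rfl⟩
end
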